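/- arXiv:2412.19753 — 10 statements merged into one kernel-verified Lean document; each statement's English description precedes it below -/
import Mathlib

section
/- Let (I,≤) be a linear order, let ⟨F_i : i ∈ I⟩ be a ∣~-chain of ultrafilters on ℕ (that is, i ≤ j implies F_i ∣~ F_j), and let H be an ultrafilter on I containing every final segment {j ∈ I : i ≤ j} (for every i ∈ I). Then the ultrafilter G := lim_{i→H} F_i is a least upper bound of the chain with respect to ∣~: F_i ∣~ G for every i ∈ I, and for every ultrafilter G' on ℕ satisfying F_i ∣~ G' for all i ∈ I, one has G ∣~ G'. -/
/-- A set of positive integers is upward closed for divisibility. -/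
def UpClosed (A : Set ℕ+) : Prop := ∀ a ∈ A, ∀ n : ℕ+, a ∣ n → n ∈ A

/-- The divisibility relation on ultrafilters: `F ∣~ G` iff every nonempty
upward closed set in `F` belongs to `G`. -/
def UDvd (F G : Ultrafilter ℕ+) : Prop :=
  ∀ A : Set ℕ+, A ∈ F → A.Nonempty → UpClosed A → A ∈ G

theorem stmt_0 {I : Type*} [LinearOrder I] (F : I → Ultrafilter ℕ+)
    (hchain : ∀ i j : I, i ≤ j → UDvd (F i) (F j))
    (H : Ultrafilter I) (hH : ∀ i : I, {j : I | i ≤ j} ∈ H)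
    (G : Ultrafilter ℕ+)
    (hG : ∀ A : Set ℕ+, A ∈ G ↔ {i : I | A ∈ F i} ∈ H) :
    (∀ i : I, UDvd (F i) G) ∧
      ∀ G' : Ultrafilter ℕ+, (∀ i : I, UDvd (F i) G') → UDvd G G' := by
  refine ⟨fun i A hA hne hup => ?_, fun G' hG' A hA hne hup => ?_⟩
  · exact (hG A).2 (Filter.mem_of_superset (hH i) fun j hij => hchain i j hij A hA hne hup)
  · obtain ⟨i, hi⟩ := H.nonempty_of_mem ((hG A).1 hA)
    exact hG' i A hi hne hup
end

section
/- Let (I,≤) be a linear order, let ⟨F_i : i ∈ I⟩ be a ∣~-chain of ultrafilters on ℕ (that is, i ≤ j implies F_i ∣~ F_j), and let H be an ultrafilter on I containing every initial segment {j ∈ I : j ≤ i} (for every i ∈ I). Then the ultrafilter G := lim_{i→H} F_i is a greatest lower bound of the chain with respect to ∣~: G ∣~ F_i for every i ∈ I, and for every ultrafilter G' on ℕ satisfying G' ∣~ F_i for all i ∈ I, one has G' ∣~ G. -/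
theorem stmt_1 {I : Type*} [LinearOrder I] (F : I → Ultrafilter ℕ+)
    (hchain : ∀ i j : I, i ≤ j → UDvd (F i) (F j))
    (H : Ultrafilter I) (hH : ∀ i : I, {j : I | j ≤ i} ∈ H)
    (G : Ultrafilter ℕ+)
    (hG : ∀ A : Set ℕ+, A ∈ G ↔ {i : I | A ∈ F i} ∈ H) :
    (∀ i : I, UDvd G (F i)) ∧
      ∀ G' : Ultrafilter ℕ+, (∀ i : I, UDvd G' (F i)) → UDvd G' G := by
  refine ⟨fun i A hA hne hup => ?_, fun G' hG' A hA hne hup => ?_⟩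
  · obtain ⟨j, hj, hji⟩ :=
      H.nonempty_of_mem (Filter.inter_mem ((hG A).1 hA) (hH i))
    exact hchain j i hji A hj hne hup
  · exact (hG A).2 (Filter.univ_mem' fun i => hG' i A hA hne hup)
end

section
/- Let (I,≤) be a linear order, let ⟨F_i : i ∈ I⟩ be a ∣~-chain of ultrafilters on ℕ (that is, i ≤ j implies F_i ∣~ F_j), let H be an ultrafilter on I containing every final segment {j ∈ I : i ≤ j}, and let G := lim_{i→H} F_i. Then for every nonempty upward closed set A ⊆ ℕ: A ∈ G if and only if A ∈ F_i for some i ∈ I (i.e., G ∩ U = ⋃_{i∈I} (F_i ∩ U)). -/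
theorem stmt_2 {I : Type*} [LinearOrder I] (F : I → Ultrafilter ℕ+)
    (hchain : ∀ i j : I, i ≤ j → UDvd (F i) (F j))
    (H : Ultrafilter I) (hH : ∀ i : I, {j : I | i ≤ j} ∈ H)
    (G : Ultrafilter ℕ+)
    (hG : ∀ A : Set ℕ+, A ∈ G ↔ {i : I | A ∈ F i} ∈ H) :
    ∀ A : Set ℕ+, A.Nonempty → UpClosed A → (A ∈ G ↔ ∃ i : I, A ∈ F i) := by
  intro A hne hup
  rw [hG]
  constructor
  · exact fun h => H.nonempty_of_mem h
  · rintro ⟨i, hi⟩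
    exact Filter.mem_of_superset (hH i) fun j hij => hchain i j hij A hi hne hup
end

section
/- Let (I,≤) be a linear order, let ⟨F_i : i ∈ I⟩ be a ∣~-chain of ultrafilters on ℕ (that is, i ≤ j implies F_i ∣~ F_j), let H be an ultrafilter on I containing every initial segment {j ∈ I : j ≤ i}, and let G := lim_{i→H} F_i. Then for every nonempty upward closed set A ⊆ ℕ: A ∈ G if and only if A ∈ F_i for all i ∈ I (i.e., G ∩ U = ⋂_{i∈I} (F_i ∩ U)). -/
theorem stmt_3 {I : Type*} [LinearOrder I] (F : I → Ultrafilter ℕ+)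
    (hchain : ∀ i j : I, i ≤ j → UDvd (F i) (F j))
    (H : Ultrafilter I) (hH : ∀ i : I, {j : I | j ≤ i} ∈ H)
    (G : Ultrafilter ℕ+)
    (hG : ∀ A : Set ℕ+, A ∈ G ↔ {i : I | A ∈ F i} ∈ H) :
    ∀ A : Set ℕ+, A.Nonempty → UpClosed A → (A ∈ G ↔ ∀ i : I, A ∈ F i) := by
  intro A hne hA
  rw [hG]
  constructor
  · intro h i
    obtain ⟨j, hj, hji⟩ := H.nonempty_of_mem (Filter.inter_mem h (hH i))
    exact hchain j i hji A hj hne hA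
  · intro h
    exact Filter.mem_of_superset Filter.univ_mem fun i _ => h i
end

section
/- Let (I,≤) be a linear order, let ⟨F_i : i ∈ I⟩ be a ∣~-chain of ultrafilters on ℕ (i ≤ j implies F_i ∣~ F_j), and let H₁, H₂ be two ultrafilters on I, each containing every final segment {j ∈ I : i ≤ j}. Then lim_{i→H₁} F_i =~ lim_{i→H₂} F_i; that is, the =~-equivalence class of the limit of the chain does not depend on the choice of the ultrafilter over which the limit is taken, as long as it contains all final segments of I. -/
/-- The limit `G₁` of a chain of ultrafilters along any ultrafilter divides its limit `G₂` along an
ultrafilter containing all final segments. -/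
theorem uDvd_of_limits {I : Type*} [Preorder I] {F : I → Ultrafilter ℕ+}
    (hchain : ∀ i j : I, i ≤ j → UDvd (F i) (F j))
    {H₁ H₂ : Ultrafilter I} (hH₂ : ∀ i : I, {j : I | i ≤ j} ∈ H₂)
    {G₁ G₂ : Ultrafilter ℕ+}
    (hG₁ : ∀ A : Set ℕ+, A ∈ G₁ ↔ {i : I | A ∈ F i} ∈ H₁)
    (hG₂ : ∀ A : Set ℕ+, A ∈ G₂ ↔ {i : I | A ∈ F i} ∈ H₂) :
    UDvd G₁ G₂ := by
  intro A hA hne hup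
  obtain ⟨i, hi⟩ := Ultrafilter.nonempty_of_mem ((hG₁ A).1 hA)
  exact (hG₂ A).2 (Filter.mem_of_superset (hH₂ i) fun j hij => hchain i j hij A hi hne hup)

theorem stmt_4 {I : Type*} [LinearOrder I] (F : I → Ultrafilter ℕ+)
    (hchain : ∀ i j : I, i ≤ j → UDvd (F i) (F j))
    (H₁ H₂ : Ultrafilter I)
    (hH₁ : ∀ i : I, {j : I | i ≤ j} ∈ H₁) (hH₂ : ∀ i : I, {j : I | i ≤ j} ∈ H₂)
    (G₁ G₂ : Ultrafilter ℕ+)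
    (hG₁ : ∀ A : Set ℕ+, A ∈ G₁ ↔ {i : I | A ∈ F i} ∈ H₁)
    (hG₂ : ∀ A : Set ℕ+, A ∈ G₂ ↔ {i : I | A ∈ F i} ∈ H₂) :
    UDvd G₁ G₂ ∧ UDvd G₂ G₁ :=
  ⟨uDvd_of_limits hchain hH₂ hG₁ hG₂, uDvd_of_limits hchain hH₁ hG₂ hG₁⟩
end

section
/- Let F and G be ultrafilters on ℕ with F ∣~ G, and suppose there is a set A with A ∈ F and A ∈ G which is a divisibility antichain (for all a, b ∈ A, a ∣ b implies a = b). Then F = G. -/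
theorem stmt_6 (F G : Ultrafilter ℕ+) (h : UDvd F G)
    (A : Set ℕ+) (hAF : A ∈ F) (hAG : A ∈ G)
    (hanti : ∀ a ∈ A, ∀ b ∈ A, a ∣ b → a = b) : F = G := by
  refine (Ultrafilter.coe_le_coe.1 fun S hS => ?_).symm
  have hSA : S ∩ A ∈ F := F.inter_sets hS hAF
  have hsub : S ∩ A ⊆ {n | ∃ a ∈ S ∩ A, a ∣ n} := fun a ha => ⟨a, ha, dvd_rfl⟩
  have hup : {n | ∃ a ∈ S ∩ A, a ∣ n} ∈ G :=
    h _ (F.sets_of_superset hSA hsub) ((F.nonempty_of_mem hSA).mono hsub)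
      fun _ ⟨a, ha, ham⟩ _ hmn => ⟨a, ha, ham.trans hmn⟩
  refine Filter.mem_of_superset (Filter.inter_mem hup hAG) ?_
  rintro n ⟨⟨a, ha, han⟩, hn⟩
  exact hanti a ha.2 n hn han ▸ ha.1
end

section
/- For every ultrafilter F on ℕ the following conditions are equivalent: (i) the =~-equivalence class of F is a singleton, i.e., every ultrafilter G on ℕ with G =~ F satisfies G = F; (ii) there exists a set A ∈ F which is a divisibility antichain (for all a, b ∈ A, a ∣ b implies a = b). -/
/-- The filter generated by the convex sets `U \ V` (with `U`, `V` upward closed) belonging to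
an ultrafilter. -/
def convexFilter (F : Ultrafilter ℕ+) : Filter ℕ+ where
  sets := {T | ∃ U V, UpClosed U ∧ UpClosed V ∧ U ∈ F ∧ V ∉ F ∧ U \ V ⊆ T}
  univ_sets := ⟨Set.univ, ∅, fun _ _ _ _ => trivial, fun _ h => h.elim, Filter.univ_mem,
    F.empty_notMem, Set.subset_univ _⟩
  sets_of_superset := by
    rintro S T ⟨U, V, hU, hV, hUF, hVF, h⟩ hST
    exact ⟨U, V, hU, hV, hUF, hVF, h.trans hST⟩
  inter_sets := by
    rintro S T ⟨U, V, hU, hV, hUF, hVF, h⟩ ⟨U', V', hU', hV', hUF', hVF', h'⟩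
    refine ⟨U ∩ U', V ∪ V', fun a ha n hn => ⟨hU a ha.1 n hn, hU' a ha.2 n hn⟩,
      fun a ha n hn => ha.imp (hV a · n hn) (hV' a · n hn), Filter.inter_mem hUF hUF',
      fun H => (Ultrafilter.union_mem_iff.1 H).elim hVF hVF', ?_⟩
    rintro x ⟨⟨hx, hx'⟩, hn⟩
    exact ⟨h ⟨hx, fun hv => hn (Or.inl hv)⟩, h' ⟨hx', fun hv => hn (Or.inr hv)⟩⟩

theorem mem_convexFilter {F : Ultrafilter ℕ+} {T : Set ℕ+} :
    T ∈ convexFilter F ↔ ∃ U V, UpClosed U ∧ UpClosed V ∧ U ∈ F ∧ V ∉ F ∧ U \ V ⊆ T :=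
  Iff.rfl

theorem uDvd_and_uDvd_of_le_convexFilter {F G : Ultrafilter ℕ+}
    (h : (G : Filter ℕ+) ≤ convexFilter F) : UDvd G F ∧ UDvd F G := by
  constructor
  · intro A hA _ hup
    by_contra hAF
    have hc : Aᶜ ∈ convexFilter F := ⟨Set.univ, A, fun _ _ _ _ => trivial, hup,
      Filter.univ_mem, hAF, fun x hx => hx.2⟩
    exact Ultrafilter.compl_mem_iff_notMem.1 (h hc) hA
  · intro A hA _ hup
    exact h ⟨A, ∅, hup, fun _ h => h.elim, hA, F.empty_notMem, fun x hx => hx.1⟩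

theorem mem_convexFilter_of_forall_eq {F : Ultrafilter ℕ+}
    (h : ∀ G : Ultrafilter ℕ+, UDvd G F ∧ UDvd F G → G = F) {S : Set ℕ+} (hS : S ∈ F) :
    S ∈ convexFilter F := by
  rw [Filter.mem_iff_ultrafilter]
  intro G hG
  rwa [h G (uDvd_and_uDvd_of_le_convexFilter hG)]

/-- A proper divisibility has an intermediate number with exactly one more prime factor. -/
theorem exists_between_of_dvd_of_ne {a b : ℕ+} (h : a ∣ b) (hne : a ≠ b) :
    ∃ c, a ∣ c ∧ c ∣ b ∧ c.factorMultiset.card = a.factorMultiset.card + 1 := by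
  obtain ⟨k, rfl⟩ := h
  have hk : k ≠ 1 := by
    rintro rfl
    exact hne (mul_one a).symm
  obtain ⟨p, hp, hpk⟩ := PNat.exists_prime_and_dvd hk
  refine ⟨a * p, dvd_mul_right _ _, mul_dvd_mul_left a hpk, ?_⟩
  let q : Nat.Primes := ⟨p, hp⟩
  have hq : p.factorMultiset = PrimeMultiset.ofPrime q := PNat.factorMultiset_ofPrime q
  rw [PNat.factorMultiset_mul, hq]
  exact Multiset.card_add _ _

theorem eq_of_dvd_of_mem_convex {U V : Set ℕ+} (hU : UpClosed U) (hV : UpClosed V)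
    (hpar : ∀ x ∈ U \ V, ∀ y ∈ U \ V,
      (Even x.factorMultiset.card ↔ Even y.factorMultiset.card)) :
    ∀ a ∈ U \ V, ∀ b ∈ U \ V, a ∣ b → a = b := by
  intro a ha b hb hab
  by_contra hne
  obtain ⟨c, hac, hcb, hcard⟩ := exists_between_of_dvd_of_ne hab hne
  have := hpar a ha c ⟨hU a ha.1 c hac, fun hc => hb.2 (hV c hc b hcb)⟩
  rw [hcard, Nat.even_add_one] at this
  exact iff_not_self this

theorem exists_antichain_of_forall_eq {F : Ultrafilter ℕ+}
    (h : ∀ G : Ultrafilter ℕ+, UDvd G F ∧ UDvd F G → G = F) :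
    ∃ A ∈ F, ∀ a ∈ A, ∀ b ∈ A, a ∣ b → a = b := by
  obtain hE | hE := F.mem_or_compl_mem {n : ℕ+ | Even n.factorMultiset.card} <;>
    obtain ⟨U, V, hU, hV, hUF, hVF, hUV⟩ :=
      mem_convexFilter.1 (mem_convexFilter_of_forall_eq h hE) <;>
    refine ⟨U \ V, Filter.inter_mem hUF (Ultrafilter.compl_mem_iff_notMem.2 hVF),
      eq_of_dvd_of_mem_convex hU hV fun x hx y hy => ?_⟩
  · exact iff_of_true (hUV hx) (hUV hy)
  · exact iff_of_false (hUV hx) (hUV hy)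

theorem mem_of_antichain_mem {F G : Ultrafilter ℕ+} (hGF : UDvd G F) (hFG : UDvd F G)
    {A : Set ℕ+} (hA : A ∈ F) (hanti : ∀ a ∈ A, ∀ b ∈ A, a ∣ b → a = b) : A ∈ G := by
  set U : Set ℕ+ := {n | ∃ a ∈ A, a ∣ n}
  have hAU : A ⊆ U := fun a ha => ⟨a, ha, dvd_rfl⟩
  have hU : UpClosed U := fun x ⟨a, ha, hax⟩ n hn => ⟨a, ha, hax.trans hn⟩
  have hUF : U ∈ F := Filter.mem_of_superset hA hAU
  have hUG : U ∈ G := hFG U hUF (F.nonempty_of_mem hUF) hU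
  have hV : UpClosed (U \ A) := by
    rintro x ⟨⟨a, ha, hax⟩, hx⟩ n hn
    refine ⟨⟨a, ha, hax.trans hn⟩, fun hnA => hx ?_⟩
    obtain rfl := hanti a ha n hnA (hax.trans hn)
    rwa [← PNat.dvd_antisymm hax hn]
  by_contra hAG
  have hVG : U \ A ∈ G := Filter.inter_mem hUG (Ultrafilter.compl_mem_iff_notMem.2 hAG)
  have hVF := hGF _ hVG (G.nonempty_of_mem hVG) hV
  exact Ultrafilter.compl_mem_iff_notMem.1 (Filter.mem_of_superset hVF fun x hx => hx.2) hA

theorem stmt_7 (F : Ultrafilter ℕ+) :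
    (∀ G : Ultrafilter ℕ+, UDvd G F ∧ UDvd F G → G = F) ↔
      ∃ A ∈ F, ∀ a ∈ A, ∀ b ∈ A, a ∣ b → a = b := by
  refine ⟨exists_antichain_of_forall_eq, ?_⟩
  rintro ⟨A, hA, hanti⟩ G ⟨hGF, hFG⟩
  refine Ultrafilter.coe_le_coe.1 fun S hS => ?_
  exact Filter.mem_of_superset
    (mem_of_antichain_mem hGF hFG (Filter.inter_mem hS hA)
      fun a ha b hb => hanti a ha.2 b hb.2) Set.inter_subset_left
end

section
/- Let (I,≤) be a linear order with no greatest element, let ⟨F_i : i ∈ I⟩ be a strictly ∣~-increasing chain of ultrafilters on ℕ (for i < j, F_i ∣~ F_j and not F_j ∣~ F_i), let H be an ultrafilter on I containing every final segment {j ∈ I : i ≤ j}, and let G := lim_{i→H} F_i. Then the =~-equivalence class of G is not a singleton: there exists an ultrafilter G' ≠ G with G' =~ G. -/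
/-- An ultrafilter that is alone in its `=~`-class has a base of differences of upward closed
sets. -/
theorem exists_diff_subset_of_unique (G : Ultrafilter ℕ+)
    (huniq : ∀ G' : Ultrafilter ℕ+, UDvd G' G → UDvd G G' → G' = G)
    {P : Set ℕ+} (hP : P ∈ G) :
    ∃ B C : Set ℕ+, UpClosed B ∧ UpClosed C ∧ B ∈ G ∧ C ∉ G ∧ B \ C ⊆ P := by
  let f : Filter ℕ+ :=
    { sets := {S | ∃ B C : Set ℕ+, UpClosed B ∧ UpClosed C ∧ B ∈ G ∧ C ∉ G ∧ B \ C ⊆ S}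
      univ_sets := ⟨Set.univ, ∅, fun _ _ _ _ => trivial, fun _ h => h.elim, Filter.univ_mem,
        G.empty_notMem, Set.subset_univ _⟩
      sets_of_superset := by
        rintro S T ⟨B, C, hB, hC, hBG, hCG, h⟩ hST
        exact ⟨B, C, hB, hC, hBG, hCG, h.trans hST⟩
      inter_sets := by
        rintro S T ⟨B, C, hB, hC, hBG, hCG, h⟩ ⟨B', C', hB', hC', hBG', hCG', h'⟩
        refine ⟨B ∩ B', C ∪ C', ?_, ?_, Filter.inter_mem hBG hBG', ?_, ?_⟩
        · exact fun a ha n han => ⟨hB a ha.1 n han, hB' a ha.2 n han⟩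
        · exact fun a ha n han => ha.imp (hC a · n han) (hC' a · n han)
        · rw [Ultrafilter.union_mem_iff]
          tauto
        · exact fun n hn => ⟨h ⟨hn.1.1, fun hc => hn.2 (Or.inl hc)⟩,
            h' ⟨hn.1.2, fun hc => hn.2 (Or.inr hc)⟩⟩ }
  by_contra hcon
  have hPf : P ∉ f := hcon
  have hne : (f ⊓ Filter.principal Pᶜ).NeBot := by
    rw [Filter.neBot_iff]
    intro hbot
    exact hPf (by simpa using Filter.mem_iff_inf_principal_compl.mpr hbot)
  let G' : Ultrafilter ℕ+ := Ultrafilter.of (f ⊓ Filter.principal Pᶜ)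
  have hle : (G' : Filter ℕ+) ≤ f ⊓ Filter.principal Pᶜ := Ultrafilter.of_le _
  have hf : ∀ S ∈ f, S ∈ G' := fun S hS => hle (Filter.mem_inf_of_left hS)
  have hPG' : Pᶜ ∈ G' := hle (Filter.mem_inf_of_right (Filter.mem_principal_self _))
  have hEq : G' = G := by
    apply huniq
    · intro A hA _ hup
      by_contra hAG
      have hAc : Aᶜ ∈ G' := hf _ ⟨Set.univ, A, fun _ _ _ _ => trivial, hup, Filter.univ_mem, hAG,
        fun n hn => hn.2⟩
      exact Ultrafilter.compl_mem_iff_notMem.mp hAc hA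
    · intro A hA _ hup
      exact hf _ ⟨A, ∅, hup, fun _ h => h.elim, hA, G.empty_notMem, Set.sdiff_subset⟩
  rw [hEq] at hPG'
  exact Ultrafilter.compl_mem_iff_notMem.mp hPG' hP

/-- A proper multiple of `a` is divisible by a multiple of `a` with one more prime factor. -/
theorem exists_dvd_cardFactors_succ {a c : ℕ+} (hac : a ∣ c) (hne : a ≠ c) :
    ∃ b : ℕ+, a ∣ b ∧ b ∣ c ∧
      ArithmeticFunction.cardFactors (b : ℕ) = ArithmeticFunction.cardFactors (a : ℕ) + 1 := by
  obtain ⟨k, rfl⟩ := hac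
  have hk : (k : ℕ) ≠ 1 := by
    intro h
    have : k = 1 := PNat.coe_eq_one_iff.mp h
    simp [this] at hne
  obtain ⟨p, hp, hpk⟩ := Nat.exists_prime_and_dvd hk
  lift p to ℕ+ using hp.pos
  refine ⟨a * p, dvd_mul_right _ _, mul_dvd_mul_left _ (PNat.dvd_iff.mpr hpk), ?_⟩
  rw [PNat.mul_coe, ArithmeticFunction.cardFactors_mul a.ne_zero hp.ne_zero,
    ArithmeticFunction.cardFactors_apply_prime hp]

/-- An ultrafilter that is alone in its `=~`-class contains an antichain for divisibility. -/
theorem exists_antichain_mem_of_unique (G : Ultrafilter ℕ+)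
    (huniq : ∀ G' : Ultrafilter ℕ+, UDvd G' G → UDvd G G' → G' = G) :
    ∃ D ∈ G, ∀ a ∈ D, ∀ c ∈ D, a ∣ c → a = c := by
  let P : Set ℕ+ := {n | Even (ArithmeticFunction.cardFactors (n : ℕ))}
  have key : ∃ B C : Set ℕ+, UpClosed B ∧ UpClosed C ∧ B ∈ G ∧ C ∉ G ∧
      ∀ a ∈ B \ C, ∀ b ∈ B \ C, (a ∈ P ↔ b ∈ P) := by
    rcases Ultrafilter.mem_or_compl_mem G P with h | h <;>
    obtain ⟨B, C, hB, hC, hBG, hCG, hs⟩ := exists_diff_subset_of_unique G huniq h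
    · exact ⟨B, C, hB, hC, hBG, hCG, fun a ha b hb => iff_of_true (hs ha) (hs hb)⟩
    · exact ⟨B, C, hB, hC, hBG, hCG, fun a ha b hb => iff_of_false (hs ha) (hs hb)⟩
  obtain ⟨B, C, hB, hC, hBG, hCG, hs⟩ := key
  refine ⟨B \ C, Filter.inter_mem hBG (Ultrafilter.compl_mem_iff_notMem.mpr hCG), ?_⟩
  intro a ha c hc hac
  by_contra hne
  obtain ⟨b, hab, hbc, hcard⟩ := exists_dvd_cardFactors_succ hac hne
  have hb : b ∈ B \ C := ⟨hB a ha.1 b hab, fun h => hc.2 (hC b h c hbc)⟩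
  have hpar := hs a ha b hb
  simp only [P, Set.mem_ofPred_eq, hcard, Nat.even_add_one] at hpar
  tauto

/-- On ultrafilters sharing an antichain, the relation `∣~` is symmetric. -/
theorem UDvd.symm_of_antichain {E F : Ultrafilter ℕ+} {D : Set ℕ+}
    (hD : ∀ a ∈ D, ∀ c ∈ D, a ∣ c → a = c) (hDE : D ∈ E) (hDF : D ∈ F) (h : UDvd E F) :
    UDvd F E := by
  intro A hAF _ _
  by_contra hAE
  have hDA : D \ A ∈ E := Filter.inter_mem hDE (Ultrafilter.compl_mem_iff_notMem.mpr hAE)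
  have hsub : D \ A ⊆ {n | ∃ d ∈ D \ A, d ∣ n} := fun d hd => ⟨d, hd, dvd_rfl⟩
  have hup : {n | ∃ d ∈ D \ A, d ∣ n} ∈ F :=
    h _ (Filter.mem_of_superset hDA hsub) ((Ultrafilter.nonempty_of_mem hDA).mono hsub)
      fun _ ⟨d, hd, hda⟩ _ han => ⟨d, hd, hda.trans han⟩
  obtain ⟨n, ⟨⟨d, hd, hdn⟩, hnA⟩, hnD⟩ :=
    Ultrafilter.nonempty_of_mem (Filter.inter_mem (Filter.inter_mem hup hAF) hDF)
  exact hd.2 (hD d hd.1 n hnD hdn ▸ hnA)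

theorem stmt_8 {I : Type*} [LinearOrder I] (hnomax : ∀ i : I, ∃ j : I, i < j)
    (F : I → Ultrafilter ℕ+)
    (hchain : ∀ i j : I, i < j → UDvd (F i) (F j) ∧ ¬ UDvd (F j) (F i))
    (H : Ultrafilter I) (hH : ∀ i : I, {j : I | i ≤ j} ∈ H)
    (G : Ultrafilter ℕ+)
    (hG : ∀ A : Set ℕ+, A ∈ G ↔ {i : I | A ∈ F i} ∈ H) :
    ∃ G' : Ultrafilter ℕ+, G' ≠ G ∧ UDvd G' G ∧ UDvd G G' := by
  by_contra hcon
  obtain ⟨D, hDG, hD⟩ := exists_antichain_mem_of_unique G fun G' h₁ h₂ =>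
    by_contra fun hne => hcon ⟨G', hne, h₁, h₂⟩
  have hDH := (hG D).mp hDG
  obtain ⟨i, hi⟩ := Ultrafilter.nonempty_of_mem hDH
  obtain ⟨j, hij⟩ := hnomax i
  obtain ⟨k, hk, hjk⟩ := Ultrafilter.nonempty_of_mem (Filter.inter_mem hDH (hH j))
  obtain ⟨hle, hnle⟩ := hchain i k (hij.trans_le hjk)
  exact hnle (hle.symm_of_antichain hD hi hk)
end

section
/- Let F be a nonprincipal ultrafilter on ℕ containing a set C that is a divisibility chain (for all a, b ∈ C, a ∣ b or b ∣ a). Then the =~-equivalence class of F is not a singleton: there exists an ultrafilter G ≠ F with G =~ F. -/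
open Filter in
/-- A nonprincipal ultrafilter containing a divisibility chain contains every upward closed set
that meets the chain. -/
theorem UpClosed.mem_of_chain {G : Ultrafilter ℕ+} {A C : Set ℕ+} (hA : UpClosed A)
    (hG : (G : Filter ℕ+) ≤ cofinite) (hCG : C ∈ G)
    (hchain : ∀ a ∈ C, ∀ b ∈ C, a ∣ b ∨ b ∣ a) (hne : (A ∩ C).Nonempty) : A ∈ G := by
  obtain ⟨a, haA, haC⟩ := hne
  have hfin : {b : ℕ+ | b ∣ a}.Finite :=
    (Set.finite_Iic a).subset fun b hb => PNat.le_of_dvd hb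
  filter_upwards [hCG, hG hfin.compl_mem_cofinite] with b hbC hb
  exact hA a haA b ((hchain a haC b hbC).resolve_right hb)

open Filter in
/-- Every nonprincipal ultrafilter has, on each of its members, another nonprincipal ultrafilter
distinct from it. -/
theorem Ultrafilter.exists_ne_le_cofinite {α : Type*} {F : Ultrafilter α}
    (hF : (F : Filter α) ≤ cofinite) {C : Set α} (hC : C ∈ F) :
    ∃ G : Ultrafilter α, G ≠ F ∧ (G : Filter α) ≤ cofinite ∧ C ∈ G := by
  have hinf : C.Infinite := fun h => F.compl_notMem_iff.2 hC (hF h.compl_mem_cofinite)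
  obtain ⟨E, hEC, hE, hEF⟩ : ∃ E ⊆ C, E.Infinite ∧ E ∉ F := by
    obtain ⟨s, t, rfl, hdisj, hcard⟩ := hinf.exists_union_disjoint_cardinal_eq_of_infinite
    have hiff : s.Infinite ↔ t.Infinite := by
      rw [← Set.infinite_coe_iff, ← Set.infinite_coe_iff]
      exact (Cardinal.eq.1 hcard).some.infinite_iff
    have hs : s.Infinite := (Set.infinite_union.1 hinf).elim id hiff.2
    by_cases hsF : s ∈ F
    · refine ⟨t, Set.subset_union_right, hiff.1 hs, fun htF => ?_⟩
      exact F.empty_notMem (hdisj.inter_eq ▸ inter_mem hsF htF)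
    · exact ⟨s, Set.subset_union_left, hs, hsF⟩
  have : (cofinite ⊓ 𝓟 E).NeBot := cofinite_inf_principal_neBot_iff.2 hE
  have hle := Ultrafilter.of_le (cofinite ⊓ 𝓟 E)
  have hEG : E ∈ Ultrafilter.of (cofinite ⊓ 𝓟 E) := le_principal_iff.1 (hle.trans inf_le_right)
  exact ⟨_, fun h => hEF (h ▸ hEG), hle.trans inf_le_left, mem_of_superset hEG hEC⟩

theorem stmt_9 (F : Ultrafilter ℕ+) (hnp : ∀ n : ℕ+, F ≠ pure n)
    (C : Set ℕ+) (hCF : C ∈ F) (hchain : ∀ a ∈ C, ∀ b ∈ C, a ∣ b ∨ b ∣ a) :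
    ∃ G : Ultrafilter ℕ+, G ≠ F ∧ UDvd G F ∧ UDvd F G := by
  have hF : (F : Filter ℕ+) ≤ Filter.cofinite :=
    F.le_cofinite_or_eq_pure.resolve_right fun ⟨n, hn⟩ => hnp n hn
  obtain ⟨G, hGF, hG, hCG⟩ := F.exists_ne_le_cofinite hF hCF
  exact ⟨G, hGF,
    fun A hAG _ hA => hA.mem_of_chain hF hCF hchain (G.nonempty_of_mem (Filter.inter_mem hAG hCG)),
    fun A hAF _ hA => hA.mem_of_chain hG hCG hchain (F.nonempty_of_mem (Filter.inter_mem hAF hCF))⟩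
end

section
/- The maximum class MAX of the divisibility order on ultrafilters has no immediate predecessor. Precisely: for every ultrafilter F on ℕ such that some ultrafilter G on ℕ does not satisfy G ∣~ F (i.e., F ∉ MAX), there exists an ultrafilter H on ℕ such that F ∣~ H, not H ∣~ F, and some ultrafilter G' on ℕ does not satisfy G' ∣~ H (i.e., H ∉ MAX); so H lies strictly between F and the maximum class. -/
theorem upClosed_multiples (n : ℕ+) : UpClosed {d : ℕ+ | n ∣ d} :=
  fun _ ha _ hn => dvd_trans ha hn

theorem dvd_of_mul_self_dvd_lcm {d n : ℕ+} (h : n * n ∣ PNat.lcm d n) : n ∣ d := by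
  obtain ⟨c, hc⟩ := h
  have key := PNat.gcd_mul_lcm d n
  rw [hc] at key
  refine ⟨PNat.gcd d n * c, mul_right_cancel (b := n) ?_⟩
  rw [← key]
  ac_rfl

theorem stmt_10 (F : Ultrafilter ℕ+) (hF : ∃ G : Ultrafilter ℕ+, ¬ UDvd G F) :
    ∃ H : Ultrafilter ℕ+, UDvd F H ∧ ¬ UDvd H F ∧
      ∃ G' : Ultrafilter ℕ+, ¬ UDvd G' H := by
  obtain ⟨G, hG⟩ := hF
  unfold UDvd at hG
  push Not at hG
  obtain ⟨A, -, ⟨n, hnA⟩, hA, hAF⟩ := hG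
  have hn : {d : ℕ+ | n ∣ d} ∉ F := fun h =>
    hAF (Filter.mem_of_superset h fun d hd => hA n hnA d hd)
  refine ⟨F.map fun d => PNat.lcm d n, ?_, ?_, pure (n * n), ?_⟩
  · intro B hB _ hBup
    rw [Ultrafilter.mem_map]
    exact Filter.mem_of_superset hB fun d hd => hBup d hd _ (PNat.dvd_lcm_left d n)
  · intro h
    refine hn (h _ ?_ ⟨n, dvd_refl n⟩ (upClosed_multiples n))
    rw [Ultrafilter.mem_map]
    exact Filter.mem_of_superset Filter.univ_mem fun d _ => PNat.dvd_lcm_right d n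
  · intro h
    have hmem := h _ (Ultrafilter.mem_pure.mpr (dvd_refl (n * n))) ⟨n * n, dvd_refl (n * n)⟩
      (upClosed_multiples (n * n))
    rw [Ultrafilter.mem_map] at hmem
    exact hn (Filter.mem_of_superset hmem fun d hd => dvd_of_mul_self_dvd_lcm hd)
end
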